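/- Let σ be continuously differentiable and positive on an open neighborhood of the closed unit square, let z₀, z₁ > 0, and let I₀, I₁ ∈ ℝ satisfy I₀ + I₁ = 0. Let u be twice continuously differentiable on an open neighborhood of the closed square and U = (U₀,U₁) ∈ ℝ² with U₀ + U₁ = 0. Suppose that for every v continuously differentiable on an open neighborhood of the closed square and every V = (V₀,V₁) ∈ ℝ² with V₀ + V₁ = 0 one has ∫_Ω σ∇u·∇v dxdy + (1/z₀)∫₀¹(u(x,0)−U₀)(v(x,0)−V₀) dx + (1/z₁)∫₀¹(u(x,1)−U₁)(v(x,1)−V₁) dx − I₀V₀ − I₁V₁ = 0. Then (u, U) is a classical CEM solution for σ: div(σ∇u) = 0 in Ω, the Robin conditions hold on the bottom and top edges, the flux conditions with currents I₀ and I₁ hold, and ∂_x u vanishes on the left and right edges. -/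

import Mathlib

open MeasureTheory Set

/-- Partial derivative in the first (x) variable. -/
noncomputable def pdx (u : ℝ × ℝ → ℝ) (p : ℝ × ℝ) : ℝ :=
  deriv (fun t => u (t, p.2)) p.1

/-- Partial derivative in the second (y) variable. -/
noncomputable def pdy (u : ℝ × ℝ → ℝ) (p : ℝ × ℝ) : ℝ :=
  deriv (fun t => u (p.1, t)) p.2

/-- Euclidean norm of the gradient `|∇u|`. -/
noncomputable def gradNorm (u : ℝ × ℝ → ℝ) (p : ℝ × ℝ) : ℝ :=
  Real.sqrt ((pdx u p) ^ 2 + (pdy u p) ^ 2)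

/-- The closed unit square `[0,1] × [0,1]`. -/
def SQ : Set (ℝ × ℝ) := Icc (0 : ℝ) 1 ×ˢ Icc (0 : ℝ) 1

/-- The open unit square `(0,1) × (0,1)`. -/
def SQo : Set (ℝ × ℝ) := Ioo (0 : ℝ) 1 ×ˢ Ioo (0 : ℝ) 1

/-- `v` is continuously differentiable on an open neighborhood of the closed unit square. -/
def C1Nbhd (v : ℝ × ℝ → ℝ) : Prop :=
  ∃ W : Set (ℝ × ℝ), IsOpen W ∧ SQ ⊆ W ∧ ContDiffOn ℝ 1 v W

/-- A classical solution `(u, (U₀, U₁))` of the Complete Electrode Model on the unit square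
for the conductivity `σ`, constant impedances `z₀, z₁` (bottom/top electrodes) and
input currents `I₀, I₁`. -/
structure IsCEMSolution (σ u : ℝ × ℝ → ℝ) (U₀ U₁ z₀ z₁ I₀ I₁ : ℝ) : Prop where
  smooth : ∃ W : Set (ℝ × ℝ), IsOpen W ∧ SQ ⊆ W ∧ ContDiffOn ℝ 2 u W
  ground : U₀ + U₁ = 0
  pde : ∀ p ∈ SQo,
    pdx (fun q => σ q * pdx u q) p + pdy (fun q => σ q * pdy u q) p = 0
  robin_bot : ∀ x ∈ Icc (0 : ℝ) 1, u (x, 0) - z₀ * σ (x, 0) * pdy u (x, 0) = U₀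
  robin_top : ∀ x ∈ Icc (0 : ℝ) 1, u (x, 1) + z₁ * σ (x, 1) * pdy u (x, 1) = U₁
  flux_bot : (∫ x in (0 : ℝ)..1, -(σ (x, 0) * pdy u (x, 0))) = I₀
  flux_top : (∫ x in (0 : ℝ)..1, σ (x, 1) * pdy u (x, 1)) = I₁
  noflux_left : ∀ y ∈ Icc (0 : ℝ) 1, pdx u (0, y) = 0
  noflux_right : ∀ y ∈ Icc (0 : ℝ) 1, pdx u (1, y) = 0

/-- The weighted least-gradient functional `G_a` with CEM boundary terms. -/
noncomputable def Gfun (a : ℝ × ℝ → ℝ) (z₀ z₁ I₀ I₁ : ℝ) (v : ℝ × ℝ → ℝ)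
    (V₀ V₁ : ℝ) : ℝ :=
  (∫ p in SQo, a p * gradNorm v p)
    + (1 / (2 * z₀)) * (∫ x in (0 : ℝ)..1, (v (x, 0) - V₀) ^ 2)
    + (1 / (2 * z₁)) * (∫ x in (0 : ℝ)..1, (v (x, 1) - V₁) ^ 2)
    - I₀ * V₀ - I₁ * V₁

/-- The CEM energy functional `F_σ`. -/
noncomputable def Ffun (σ : ℝ × ℝ → ℝ) (z₀ z₁ I₀ I₁ : ℝ) (v : ℝ × ℝ → ℝ)
    (V₀ V₁ : ℝ) : ℝ :=
  (1 / 2) * (∫ p in SQo, σ p * ((pdx v p) ^ 2 + (pdy v p) ^ 2))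
    + (1 / (2 * z₀)) * (∫ x in (0 : ℝ)..1, (v (x, 0) - V₀) ^ 2)
    + (1 / (2 * z₁)) * (∫ x in (0 : ℝ)..1, (v (x, 1) - V₁) ^ 2)
    - I₀ * V₀ - I₁ * V₁

open scoped ContDiff

section PartialDerivatives

variable {f : ℝ × ℝ → ℝ} {W : Set (ℝ × ℝ)} {p : ℝ × ℝ} {m n : ℕ∞ω}

theorem pdx_eq_fderiv (hf : DifferentiableAt ℝ f p) : pdx f p = fderiv ℝ f p (1, 0) := by
  have h : HasFDerivAt f (fderiv ℝ f p) ((fun t : ℝ => (t, p.2)) p.1) := hf.hasFDerivAt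
  exact (h.comp_hasDerivAt p.1 ((hasDerivAt_id p.1).prodMk (hasDerivAt_const p.1 p.2))).deriv

theorem pdy_eq_fderiv (hf : DifferentiableAt ℝ f p) : pdy f p = fderiv ℝ f p (0, 1) := by
  have h : HasFDerivAt f (fderiv ℝ f p) ((fun t : ℝ => (p.1, t)) p.2) := hf.hasFDerivAt
  exact (h.comp_hasDerivAt p.2 ((hasDerivAt_const p.2 p.1).prodMk (hasDerivAt_id p.2))).deriv

theorem contDiffOn_pdx (hf : ContDiffOn ℝ n f W) (hW : IsOpen W) (hmn : m + 1 ≤ n) :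
    ContDiffOn ℝ m (pdx f) W := by
  have hn : n ≠ 0 := by rintro rfl; simp at hmn
  refine ((hf.fderiv_of_isOpen hW hmn).clm_apply
    (contDiffOn_const (c := ((1 : ℝ), (0 : ℝ))))).congr fun q hq => ?_
  exact pdx_eq_fderiv ((hf.contDiffAt (hW.mem_nhds hq)).differentiableAt hn)

theorem contDiffOn_pdy (hf : ContDiffOn ℝ n f W) (hW : IsOpen W) (hmn : m + 1 ≤ n) :
    ContDiffOn ℝ m (pdy f) W := by
  have hn : n ≠ 0 := by rintro rfl; simp at hmn
  refine ((hf.fderiv_of_isOpen hW hmn).clm_apply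
    (contDiffOn_const (c := ((0 : ℝ), (1 : ℝ))))).congr fun q hq => ?_
  exact pdy_eq_fderiv ((hf.contDiffAt (hW.mem_nhds hq)).differentiableAt hn)

end PartialDerivatives

theorem SQo_subset_SQ : SQo ⊆ SQ := prod_mono Ioo_subset_Icc_self Ioo_subset_Icc_self

theorem isOpen_SQo : IsOpen SQo := isOpen_Ioo.prod isOpen_Ioo

theorem SQ_eq_Icc : SQ = Icc ((0 : ℝ), (0 : ℝ)) (1, 1) := Icc_prod_Icc _ _ _ _

theorem isCompact_SQ : IsCompact SQ := isCompact_Icc.prod isCompact_Icc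

theorem setIntegral_SQo_eq_SQ (f : ℝ × ℝ → ℝ) : ∫ p in SQo, f p = ∫ p in SQ, f p := by
  refine setIntegral_congr_set ?_
  rw [Measure.volume_eq_prod]
  exact Measure.set_prod_ae_eq Ioo_ae_eq_Icc Ioo_ae_eq_Icc

/-- Integration by parts on the unit square. -/
theorem setIntegral_SQo_mul_pdx_add_mul_pdy {P Q v : ℝ × ℝ → ℝ} {W : Set (ℝ × ℝ)}
    (hW : IsOpen W) (hSW : SQ ⊆ W) (hP : ContDiffOn ℝ 1 P W) (hQ : ContDiffOn ℝ 1 Q W)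
    (hv : ContDiffOn ℝ 1 v W) :
    ∫ p in SQo, (P p * pdx v p + Q p * pdy v p) =
      (((∫ x in (0 : ℝ)..1, Q (x, 1) * v (x, 1)) - ∫ x in (0 : ℝ)..1, Q (x, 0) * v (x, 0)) +
          ∫ y in (0 : ℝ)..1, P (1, y) * v (1, y)) - (∫ y in (0 : ℝ)..1, P (0, y) * v (0, y)) -
        ∫ p in SQo, (pdx P p + pdy Q p) * v p := by
  have diff {f : ℝ × ℝ → ℝ} (hf : ContDiffOn ℝ 1 f W) {p : ℝ × ℝ} (hp : p ∈ SQ) :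
      DifferentiableAt ℝ f p :=
    (hf.contDiffAt (hW.mem_nhds (hSW hp))).differentiableAt one_ne_zero
  have contx {f : ℝ × ℝ → ℝ} (hf : ContDiffOn ℝ 1 f W) : ContinuousOn (pdx f) SQ :=
    ((contDiffOn_pdx (m := 0) hf hW (by simp)).continuousOn).mono hSW
  have conty {f : ℝ × ℝ → ℝ} (hf : ContDiffOn ℝ 1 f W) : ContinuousOn (pdy f) SQ :=
    ((contDiffOn_pdy (m := 0) hf hW (by simp)).continuousOn).mono hSW
  have cP := hP.continuousOn.mono hSW
  have cQ := hQ.continuousOn.mono hSW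
  have cv := hv.continuousOn.mono hSW
  have i₁ : IntegrableOn (fun p => P p * pdx v p + Q p * pdy v p) SQ :=
    ((cP.mul (contx hv)).add (cQ.mul (conty hv))).integrableOn_compact isCompact_SQ
  have i₂ : IntegrableOn (fun p => (pdx P p + pdy Q p) * v p) SQ :=
    (((contx hP).add (conty hQ)).mul cv).integrableOn_compact isCompact_SQ
  have key : EqOn (fun p => fderiv ℝ (fun q => P q * v q) p (1, 0)
      + fderiv ℝ (fun q => Q q * v q) p (0, 1))
      (fun p => (P p * pdx v p + Q p * pdy v p) + (pdx P p + pdy Q p) * v p) SQ := by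
    intro p hp
    have e₁ := fderiv_fun_mul (diff hP hp) (diff hv hp)
    have e₂ := fderiv_fun_mul (diff hQ hp) (diff hv hp)
    simp only [e₁, e₂, pdx_eq_fderiv (diff hv hp), pdy_eq_fderiv (diff hv hp),
      pdx_eq_fderiv (diff hP hp), pdy_eq_fderiv (diff hQ hp), add_apply, smul_apply, smul_eq_mul]
    ring
  have mSQ : MeasurableSet SQ := isCompact_SQ.measurableSet
  have div := integral_divergence_prod_Icc_of_hasFDerivAt_of_le
    (fun p => P p * v p) (fun p => Q p * v p)
    (fderiv ℝ fun p => P p * v p) (fderiv ℝ fun p => Q p * v p) (0, 0) (1, 1)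
    (by simp [Prod.le_def]) (SQ_eq_Icc ▸ cP.mul cv) (SQ_eq_Icc ▸ cQ.mul cv)
    (fun p hp => ((diff hP (SQo_subset_SQ hp)).mul (diff hv (SQo_subset_SQ hp))).hasFDerivAt)
    (fun p hp => ((diff hQ (SQo_subset_SQ hp)).mul (diff hv (SQo_subset_SQ hp))).hasFDerivAt)
    (SQ_eq_Icc ▸ (i₁.add i₂).congr_fun key.symm mSQ)
  rw [← SQ_eq_Icc, setIntegral_congr_fun mSQ key, integral_add i₁ i₂] at div
  rw [setIntegral_SQo_eq_SQ, setIntegral_SQo_eq_SQ]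
  linarith

/-- The fundamental lemma of the calculus of variations, up to the boundary. -/
theorem eqOn_zero_closure_of_integral_contDiff_mul_eq_zero {E : Type*} [NormedAddCommGroup E]
    [NormedSpace ℝ E] [FiniteDimensional ℝ E] [MeasurableSpace E] [BorelSpace E]
    {μ : Measure E} [μ.IsOpenPosMeasure] [IsLocallyFiniteMeasure μ] {U : Set E} (hU : IsOpen U)
    {f : E → ℝ} (hf : ContinuousOn f (closure U))
    (h : ∀ g : E → ℝ, ContDiff ℝ ∞ g → HasCompactSupport g → tsupport g ⊆ U →
      ∫ x in U, f x * g x ∂μ = 0) : EqOn f 0 (closure U) := by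
  have hfU := hf.mono subset_closure
  have ae : ∀ᵐ x ∂μ, x ∈ U → f x = 0 := by
    refine hU.ae_eq_zero_of_integral_contDiff_smul_eq_zero
      (hfU.locallyIntegrableOn hU.measurableSet) fun g hg hgc hgU => ?_
    rw [← h g hg hgc hgU, setIntegral_eq_integral_of_forall_compl_eq_zero]
    · simp only [smul_eq_mul, mul_comm]
    · intro x hx
      rw [image_eq_zero_of_notMem_tsupport fun hx' => hx (hgU hx'), mul_zero]
  have hEq : EqOn f 0 U := Measure.eqOn_open_of_ae_eq
    ((ae_restrict_iff' hU.measurableSet).2 ae) hU hfU continuousOn_const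
  exact hEq.of_subset_closure hf continuousOn_const subset_closure subset_rfl

/-- The fundamental lemma of the calculus of variations on the unit interval. -/
theorem eqOn_zero_Icc_of_intervalIntegral_mul_eq_zero {f : ℝ → ℝ}
    (hf : ContinuousOn f (Icc 0 1))
    (h : ∀ g : ℝ → ℝ, ContDiff ℝ 1 g → g 0 = 0 → g 1 = 0 →
      ∫ x in (0 : ℝ)..1, f x * g x = 0) : ∀ x ∈ Icc (0 : ℝ) 1, f x = 0 := by
  have hcl : closure (Ioo (0 : ℝ) 1) = Icc 0 1 := closure_Ioo zero_ne_one
  rw [← hcl] at hf ⊢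
  refine eqOn_zero_closure_of_integral_contDiff_mul_eq_zero (μ := volume) isOpen_Ioo hf
    fun g hg _ hgU => ?_
  have hg₀ : ∀ x ∉ Ioo (0 : ℝ) 1, g x = 0 := fun x hx =>
    image_eq_zero_of_notMem_tsupport fun hx' => hx (hgU hx')
  have hint := h g (hg.of_le (by simp)) (hg₀ 0 (by simp)) (hg₀ 1 (by simp))
  rwa [intervalIntegral.integral_of_le zero_le_one, integral_Ioc_eq_integral_Ioo] at hint

/-- If the Euler–Lagrange identity holds in every admissible direction `(v, V)` and the
injected currents satisfy `I₀ + I₁ = 0`, then `(u, U)` is a classical CEM solution. -/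
theorem euler_lagrange_implies_cem_solution (σ u : ℝ × ℝ → ℝ)
    (U₀ U₁ z₀ z₁ I₀ I₁ : ℝ)
    (hσ : ∃ W : Set (ℝ × ℝ), IsOpen W ∧ SQ ⊆ W ∧ ContDiffOn ℝ 1 σ W)
    (hσpos : ∀ p ∈ SQ, 0 < σ p)
    (hz₀ : 0 < z₀) (hz₁ : 0 < z₁) (hI : I₀ + I₁ = 0)
    (hu : ∃ W : Set (ℝ × ℝ), IsOpen W ∧ SQ ⊆ W ∧ ContDiffOn ℝ 2 u W)
    (hU : U₀ + U₁ = 0)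
    (hEL : ∀ v : ℝ × ℝ → ℝ, C1Nbhd v → ∀ V₀ V₁ : ℝ, V₀ + V₁ = 0 →
      (∫ p in SQo, σ p * (pdx u p * pdx v p + pdy u p * pdy v p))
        + (1 / z₀) * (∫ x in (0 : ℝ)..1, (u (x, 0) - U₀) * (v (x, 0) - V₀))
        + (1 / z₁) * (∫ x in (0 : ℝ)..1, (u (x, 1) - U₁) * (v (x, 1) - V₁))
        - I₀ * V₀ - I₁ * V₁ = 0) :
    IsCEMSolution σ u U₀ U₁ z₀ z₁ I₀ I₁ := by
  obtain ⟨W₁, hW₁, hS₁, hσ₁⟩ := hσ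
  have ⟨W₂, hW₂, hS₂, hu₂⟩ := hu
  obtain ⟨W, hW, hSW, hσW, huW⟩ : ∃ W : Set (ℝ × ℝ), IsOpen W ∧ SQ ⊆ W ∧
      ContDiffOn ℝ 1 σ W ∧ ContDiffOn ℝ 2 u W :=
    ⟨W₁ ∩ W₂, hW₁.inter hW₂, subset_inter hS₁ hS₂, hσ₁.mono inter_subset_left,
      hu₂.mono inter_subset_right⟩
  set P : ℝ × ℝ → ℝ := fun q => σ q * pdx u q
  set Q : ℝ × ℝ → ℝ := fun q => σ q * pdy u q with hQ
  have hPW : ContDiffOn ℝ 1 P W := hσW.mul (contDiffOn_pdx huW hW (by norm_num))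
  have hQW : ContDiffOn ℝ 1 Q W := hσW.mul (contDiffOn_pdy huW hW (by norm_num))
  have cP := hPW.continuousOn.mono hSW
  have cQ := hQW.continuousOn.mono hSW
  have cu := huW.continuousOn.mono hSW
  have cD : ContinuousOn (fun p => pdx P p + pdy Q p) SQ :=
    (((contDiffOn_pdx (m := 0) hPW hW (by simp)).continuousOn).add
      ((contDiffOn_pdy (m := 0) hQW hW (by simp)).continuousOn)).mono hSW
  have horiz {f : ℝ × ℝ → ℝ} (hf : ContinuousOn f SQ) {y : ℝ} (hy : y ∈ Icc (0 : ℝ) 1) :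
      ContinuousOn (fun x => f (x, y)) (Icc 0 1) :=
    hf.comp (by fun_prop) fun x hx => ⟨hx, hy⟩
  have vert {f : ℝ × ℝ → ℝ} (hf : ContinuousOn f SQ) {x : ℝ} (hx : x ∈ Icc (0 : ℝ) 1) :
      ContinuousOn (fun y => f (x, y)) (Icc 0 1) :=
    hf.comp (by fun_prop) fun y hy => ⟨hx, hy⟩
  have m₀ : (0 : ℝ) ∈ Icc (0 : ℝ) 1 := by simp
  have m₁ : (1 : ℝ) ∈ Icc (0 : ℝ) 1 := by simp
  have hvar (v : ℝ × ℝ → ℝ) (hv : ContDiff ℝ 1 v) :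
      (((∫ x in (0 : ℝ)..1, Q (x, 1) * v (x, 1)) - ∫ x in (0 : ℝ)..1, Q (x, 0) * v (x, 0)) +
          ∫ y in (0 : ℝ)..1, P (1, y) * v (1, y)) - (∫ y in (0 : ℝ)..1, P (0, y) * v (0, y)) -
        (∫ p in SQo, (pdx P p + pdy Q p) * v p)
        + (1 / z₀) * (∫ x in (0 : ℝ)..1, (u (x, 0) - U₀) * v (x, 0))
        + (1 / z₁) * (∫ x in (0 : ℝ)..1, (u (x, 1) - U₁) * v (x, 1)) = 0 := by
    have h := hEL v ⟨univ, isOpen_univ, subset_univ _, hv.contDiffOn⟩ 0 0 (add_zero 0)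
    simp only [sub_zero, mul_zero, mul_add, ← mul_assoc] at h
    rwa [setIntegral_SQo_mul_pdx_add_mul_pdy hW hSW hPW hQW hv.contDiffOn] at h
  have hD : ∀ p ∈ SQo, pdx P p + pdy Q p = 0 := by
    have hcl : closure SQo = SQ := by
      rw [SQo, SQ, closure_prod_eq, closure_Ioo zero_ne_one]
    have h := eqOn_zero_closure_of_integral_contDiff_mul_eq_zero (μ := volume) isOpen_SQo
      (hcl ▸ cD) fun g hg _ hgU => ?_
    · exact fun p hp => h (subset_closure hp)
    have hg₀ : ∀ p ∉ SQo, g p = 0 := fun p hp =>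
      image_eq_zero_of_notMem_tsupport fun hp' => hp (hgU hp')
    have b₁ (x : ℝ) : g (x, 0) = 0 := hg₀ _ (by simp [SQo])
    have b₂ (x : ℝ) : g (x, 1) = 0 := hg₀ _ (by simp [SQo])
    have b₃ (y : ℝ) : g (0, y) = 0 := hg₀ _ (by simp [SQo])
    have b₄ (y : ℝ) : g (1, y) = 0 := hg₀ _ (by simp [SQo])
    simpa [b₁, b₂, b₃, b₄] using hvar g (hg.of_le (by simp))
  have hDv (v : ℝ × ℝ → ℝ) : ∫ p in SQo, (pdx P p + pdy Q p) * v p = 0 :=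
    setIntegral_eq_zero_of_forall_eq_zero fun p hp => by rw [hD p hp, zero_mul]
  have int {f g : ℝ → ℝ} (hf : ContinuousOn f (Icc 0 1)) (hg : Continuous g) :
      IntervalIntegrable (fun x => f x * g x) volume 0 1 :=
    (hf.mul hg.continuousOn).intervalIntegrable_of_Icc zero_le_one
  have cu₀ : ContinuousOn (fun x => u (x, 0) - U₀) (Icc 0 1) :=
    (horiz cu m₀).sub continuousOn_const
  have cu₁ : ContinuousOn (fun x => u (x, 1) - U₁) (Icc 0 1) :=
    (horiz cu m₁).sub continuousOn_const
  have top : ∀ x ∈ Icc (0 : ℝ) 1, Q (x, 1) + 1 / z₁ * (u (x, 1) - U₁) = 0 := by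
    refine eqOn_zero_Icc_of_intervalIntegral_mul_eq_zero
      ((horiz cQ m₁).add (continuousOn_const.mul cu₁)) fun g hg hg₀ hg₁ => ?_
    have h := hvar (fun p => g p.1 * p.2) ((hg.comp contDiff_fst).mul contDiff_snd)
    rw [hDv] at h
    simp only [add_mul, mul_assoc]
    rw [intervalIntegral.integral_add (int (horiz cQ m₁) hg.continuous)
      ((int cu₁ hg.continuous).const_mul _), intervalIntegral.integral_const_mul]
    simpa [hg₀, hg₁] using h
  have bot : ∀ x ∈ Icc (0 : ℝ) 1, Q (x, 0) - 1 / z₀ * (u (x, 0) - U₀) = 0 := by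
    refine eqOn_zero_Icc_of_intervalIntegral_mul_eq_zero
      ((horiz cQ m₀).sub (continuousOn_const.mul cu₀)) fun g hg hg₀ hg₁ => ?_
    have h := hvar (fun p => g p.1 * (1 - p.2))
      ((hg.comp contDiff_fst).mul (contDiff_const.sub contDiff_snd))
    rw [hDv] at h
    simp only [sub_mul (Q _), mul_assoc]
    rw [intervalIntegral.integral_sub (int (horiz cQ m₀) hg.continuous)
      ((int cu₀ hg.continuous).const_mul _), intervalIntegral.integral_const_mul]
    simp only [hg₀, hg₁, sub_self, sub_zero, mul_zero, zero_mul, mul_one,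
      intervalIntegral.integral_zero] at h
    linarith
  have left : ∀ y ∈ Icc (0 : ℝ) 1, P (0, y) = 0 := by
    refine eqOn_zero_Icc_of_intervalIntegral_mul_eq_zero (vert cP m₀) fun g hg hg₀ hg₁ => ?_
    have h := hvar (fun p => (1 - p.1) * g p.2)
      ((contDiff_const.sub contDiff_fst).mul (hg.comp contDiff_snd))
    rw [hDv] at h
    simpa [hg₀, hg₁] using h
  have right : ∀ y ∈ Icc (0 : ℝ) 1, P (1, y) = 0 := by
    refine eqOn_zero_Icc_of_intervalIntegral_mul_eq_zero (vert cP m₁) fun g hg hg₀ hg₁ => ?_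
    have h := hvar (fun p => p.1 * g p.2) (contDiff_fst.mul (hg.comp contDiff_snd))
    rw [hDv] at h
    simpa [hg₀, hg₁] using h
  have hc (c V₀ V₁ : ℝ) (hV : V₀ + V₁ = 0) :
      (1 / z₀) * ((∫ x in (0 : ℝ)..1, (u (x, 0) - U₀)) * (c - V₀))
        + (1 / z₁) * ((∫ x in (0 : ℝ)..1, (u (x, 1) - U₁)) * (c - V₁))
        - I₀ * V₀ - I₁ * V₁ = 0 := by
    have h := hEL (fun _ => c) ⟨univ, isOpen_univ, subset_univ _, contDiffOn_const⟩ V₀ V₁ hV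
    simpa only [pdx, pdy, deriv_const, mul_zero, add_zero, integral_zero, zero_add,
      intervalIntegral.integral_mul_const] using h
  have hbot : (∫ x in (0 : ℝ)..1, Q (x, 0)) = 1 / z₀ * ∫ x in (0 : ℝ)..1, (u (x, 0) - U₀) := by
    rw [← intervalIntegral.integral_const_mul]
    refine intervalIntegral.integral_congr fun x hx => ?_
    rw [uIcc_of_le zero_le_one] at hx
    exact sub_eq_zero.1 (bot x hx)
  have htop : (∫ x in (0 : ℝ)..1, Q (x, 1)) =
      -(1 / z₁ * ∫ x in (0 : ℝ)..1, (u (x, 1) - U₁)) := by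
    rw [← intervalIntegral.integral_const_mul, ← intervalIntegral.integral_neg]
    refine intervalIntegral.integral_congr fun x hx => ?_
    rw [uIcc_of_le zero_le_one] at hx
    exact eq_neg_of_add_eq_zero_left (top x hx)
  have hone := hc 1 0 0 (add_zero 0)
  have hpot := hc 0 1 (-1) (add_neg_cancel 1)
  refine ⟨hu, hU, hD, fun x hx => ?_, fun x hx => ?_, ?_, ?_, fun y hy => ?_, fun y hy => ?_⟩
  · have h := bot x hx
    simp only [hQ] at h
    field_simp at h
    linarith
  · have h := top x hx
    simp only [hQ] at h
    field_simp at h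
    linarith
  · change (∫ x in (0 : ℝ)..1, -Q (x, 0)) = I₀
    rw [intervalIntegral.integral_neg]
    linarith
  · change (∫ x in (0 : ℝ)..1, Q (x, 1)) = I₁
    linarith
  · exact (mul_eq_zero.1 (left y hy)).resolve_left (hσpos _ ⟨m₀, hy⟩).ne'
  · exact (mul_eq_zero.1 (right y hy)).resolve_left (hσpos _ ⟨m₁, hy⟩).ne'
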